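/- arXiv:2010.01879 — 5 statements merged into one kernel-verified Lean document; each statement's English description precedes it below -/
import Mathlib

section
/- Let n ≥ 3 be an odd integer and let u_0, u_1, …, u_{⌊n/2⌋−1} be natural numbers. Define M = Σ_{i=0}^{⌊n/2⌋−1} u_i · M_i(n). Then for every 0 ≤ j < ⌊n/2⌋, the row vector Z_j = (e^{2πi(2j+1)k/n})_{0 ≤ k < n} satisfies Z_j · M = λ_j · Z_j, where λ_j = (Σ_{i=0}^{⌊n/2⌋−1} u_i · 2cos((2j+1)(2i+1)π/(2n))) · e^{−i(2j+1)π/(2n)}; in particular |λ_j| = |Σ_{i=0}^{⌊n/2⌋−1} u_i · 2cos((2j+1)(2i+1)π/(2n))|. Moreover (1, 1, …, 1) · M = 0. -/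
/-- The elementary matrix `M_i(n)`: the `n×n` complex matrix whose `(k,l)` entry is
`(−1)^i` if `k − l ≡ i⌈n/2⌉ (mod n)`, `(−1)^{i+1}` if `k − l ≡ −(i+1)⌈n/2⌉ (mod n)`,
and `0` otherwise. -/
noncomputable def elemMat (n i : ℕ) : Matrix (Fin n) (Fin n) ℂ :=
  fun k l =>
    if ((k : ℤ) - (l : ℤ)) % n = ((i : ℤ) * (((n : ℤ) + 1) / 2)) % n then (-1 : ℂ) ^ i
    else if ((k : ℤ) - (l : ℤ)) % n = (-(((i : ℤ) + 1) * (((n : ℤ) + 1) / 2))) % n then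
      (-1 : ℂ) ^ (i + 1)
    else 0

/-- A power sum over a single residue class modulo `n`, for an `n`-th root of unity. -/
lemma sum_ite_sub_emod_eq {n : ℕ} (hn : 0 < n) {w : ℂ} (hw : w ^ n = 1) (a : ℤ) (x : ℂ)
    (l : Fin n) :
    ∑ k : Fin n, w ^ (k : ℕ) * (if ((k : ℤ) - (l : ℤ)) % n = a % n then x else 0)
      = x * w ^ a * w ^ (l : ℕ) := by
  have hw0 : w ≠ 0 := by
    rintro rfl
    simp [hn.ne'] at hw
  have hn0 : (n : ℤ) ≠ 0 := by exact_mod_cast hn.ne'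
  have hpos : (0 : ℤ) < n := by exact_mod_cast hn
  have h0 := Int.emod_nonneg ((l : ℤ) + a) hn0
  have h1 := Int.emod_lt_of_pos ((l : ℤ) + a) hpos
  obtain ⟨r, hr⟩ := Int.eq_ofNat_of_zero_le h0
  have hrn : r < n := by omega
  have hdiv := Int.emod_add_mul_ediv ((l : ℤ) + a) n
  rw [Finset.sum_eq_single (⟨r, hrn⟩ : Fin n)]
  · have hmod : ((r : ℤ) - (l : ℤ)) % n = a % n := by
      rw [← hr]
      exact Int.ModEq.trans (Int.ModEq.sub_right _ (Int.mod_modEq _ _)) (by simp [Int.ModEq.refl])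
    have hpow : w ^ r = w ^ a * w ^ (l : ℕ) := by
      rw [← zpow_natCast w (l : ℕ), ← zpow_add₀ hw0, add_comm a, ← hdiv, zpow_add₀ hw0, zpow_mul,
        zpow_natCast, hw, one_zpow, mul_one, hr, ← zpow_natCast]
    simp only [hmod, if_true, hpow]
    ring
  · intro k _ hk
    rw [if_neg, mul_zero]
    intro h
    apply hk
    have h2 : (k : ℤ) % n = ((l : ℤ) + a) % n := by
      have : ((k : ℤ) - l + l) ≡ a + l [ZMOD n] := Int.ModEq.add_right _ h
      rw [sub_add_cancel, add_comm] at this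
      exact this
    rw [Int.emod_eq_of_lt (by omega) (by omega), hr] at h2
    ext
    exact Int.ofNat.inj h2
  · simp

/-- The two nonzero residue classes of `elemMat n i` are distinct, so that its entries split. -/
lemma elemMat_apply_eq_add {n i : ℕ} (hodd : Odd n) (hi : i < n / 2) (k l : Fin n) :
    elemMat n i k l =
      (if ((k : ℤ) - (l : ℤ)) % n = ((i : ℤ) * (((n : ℤ) + 1) / 2)) % n then (-1 : ℂ) ^ i else 0) +
      (if ((k : ℤ) - (l : ℤ)) % n = (-(((i : ℤ) + 1) * (((n : ℤ) + 1) / 2))) % n then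
        (-1 : ℂ) ^ (i + 1) else 0) := by
  unfold elemMat
  split_ifs with h1 h2
  · exfalso
    obtain ⟨m, rfl⟩ := hodd
    have hc : (((2 * m + 1 : ℕ) : ℤ) + 1) / 2 = m + 1 := by push_cast; omega
    rw [h1, hc] at h2
    have hd := (Int.ModEq.symm h2).dvd
    have hd' : ((2 * m + 1 : ℕ) : ℤ) ∣ 2 * i + 1 := by
      have : (2 * i + 1 : ℤ) = 2 * (i * (m + 1) - -((i + 1) * (m + 1)))
          - (2 * i + 1) * ((2 * m + 1 : ℕ) : ℤ) := by push_cast; ring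
      rw [this]
      exact dvd_sub (hd.mul_left _) (dvd_mul_left _ _)
    have := Int.le_of_dvd (by positivity) hd'
    push_cast at this
    omega
  all_goals simp

lemma vecMul_pow_elemMat {n i : ℕ} (hodd : Odd n) (hi : i < n / 2) {w : ℂ} (hw : w ^ n = 1) :
    Matrix.vecMul (fun k : Fin n => w ^ (k : ℕ)) (elemMat n i) =
      ((-1) ^ i * w ^ ((i : ℤ) * (((n : ℤ) + 1) / 2)) +
        (-1) ^ (i + 1) * w ^ (-(((i : ℤ) + 1) * (((n : ℤ) + 1) / 2)))) •
        (fun k : Fin n => w ^ (k : ℕ)) := by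
  funext l
  simp only [Matrix.vecMul, dotProduct, elemMat_apply_eq_add hodd hi, mul_add,
    Finset.sum_add_distrib, sum_ite_sub_emod_eq hodd.pos hw, Pi.smul_apply, smul_eq_mul, add_mul]

lemma vecMul_sum_smul_elemMat {n : ℕ} (hodd : Odd n) (u : Fin (n / 2) → ℂ) {w : ℂ}
    (hw : w ^ n = 1) :
    Matrix.vecMul (fun k : Fin n => w ^ (k : ℕ)) (∑ i, u i • elemMat n (i : ℕ)) =
      (∑ i, u i * ((-1) ^ (i : ℕ) * w ^ (((i : ℕ) : ℤ) * (((n : ℤ) + 1) / 2)) +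
        (-1) ^ ((i : ℕ) + 1) * w ^ (-((((i : ℕ) : ℤ) + 1) * (((n : ℤ) + 1) / 2))))) •
        (fun k : Fin n => w ^ (k : ℕ)) := by
  rw [Matrix.vecMul_sum, Finset.sum_smul]
  refine Finset.sum_congr rfl fun i _ => ?_
  rw [Matrix.vecMul_smul, vecMul_pow_elemMat hodd i.2 hw, smul_smul]

/-- The eigenvalue of `elemMat n i` at `w = exp (4 t I)`, where `exp (2 n t I) = -1`. -/
lemma elemMat_eigenvalue_eq_cos {n : ℕ} (hodd : Odd n) (i : ℕ) {t : ℂ}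
    (ht : Complex.exp (t * Complex.I) ^ (2 * n) = -1) :
    (-1) ^ i * (Complex.exp (t * Complex.I) ^ 4) ^ ((i : ℤ) * (((n : ℤ) + 1) / 2)) +
      (-1) ^ (i + 1) *
        (Complex.exp (t * Complex.I) ^ 4) ^ (-(((i : ℤ) + 1) * (((n : ℤ) + 1) / 2))) =
      2 * Complex.cos ((2 * i + 1) * t) * Complex.exp (-(t * Complex.I)) := by
  obtain ⟨m, rfl⟩ := hodd
  have hc : (((2 * m + 1 : ℕ) : ℤ) + 1) / 2 = ((m + 1 : ℕ) : ℤ) := by push_cast; omega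
  have hw : (Complex.exp (t * Complex.I) ^ 4) ^ (m + 1) = -Complex.exp (t * Complex.I) ^ 2 := by
    rw [← pow_mul, show 4 * (m + 1) = 2 * (2 * m + 1) + 2 by ring, pow_add, ht]
    ring
  have hneg (j : ℕ) : (-1 : ℂ) ^ j * (-1) ^ j = 1 := by rw [← mul_pow]; simp
  have h1 : (Complex.exp (t * Complex.I) ^ 4) ^ ((i : ℤ) * ((m + 1 : ℕ) : ℤ)) =
      (-1) ^ i * Complex.exp (t * Complex.I) ^ (2 * i) := by
    rw [mul_comm (i : ℤ), zpow_mul, zpow_natCast, zpow_natCast, hw, neg_pow, ← pow_mul]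
  have h2 : (Complex.exp (t * Complex.I) ^ 4) ^ (-(((i : ℤ) + 1) * ((m + 1 : ℕ) : ℤ))) =
      (-1) ^ (i + 1) * (Complex.exp (t * Complex.I) ^ (2 * (i + 1)))⁻¹ := by
    rw [zpow_neg, mul_comm ((i : ℤ) + 1), zpow_mul, zpow_natCast,
      show (i : ℤ) + 1 = ((i + 1 : ℕ) : ℤ) by push_cast; rfl, zpow_natCast, hw, neg_pow, ← pow_mul,
      mul_inv, ← inv_pow, inv_neg, inv_one]
  rw [hc, h1, h2, ← mul_assoc, ← mul_assoc, hneg, hneg, one_mul, one_mul, Complex.two_cos,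
    add_mul, ← Complex.exp_nat_mul, ← Complex.exp_nat_mul, ← Complex.exp_neg, ← Complex.exp_add,
    ← Complex.exp_add]
  push_cast
  congr 2 <;> ring

/-- for `M = Σ u_i · M_i(n)`, the rows `Z_j` are left eigenvectors with
eigenvalue `λ_j = (Σ_i u_i·2cos((2j+1)(2i+1)π/(2n)))·e^{−i(2j+1)π/(2n)}`, whose modulus
is `|Σ_i u_i·2cos((2j+1)(2i+1)π/(2n))|`; and the all-ones row is a left eigenvector
with eigenvalue `0`. -/
theorem sum_elemMat_left_eigenvectors (n : ℕ) (hn : 3 ≤ n) (hodd : Odd n)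
    (u : Fin (n / 2) → ℕ) :
    (∀ j : ℕ, j < n / 2 →
      Matrix.vecMul
          (fun k : Fin n =>
            Complex.exp (2 * (Real.pi : ℂ) * Complex.I * (2 * (j : ℂ) + 1) * ((k : ℕ) : ℂ) / (n : ℂ)))
          (∑ i : Fin (n / 2), ((u i : ℂ)) • elemMat n (i : ℕ))
        = ((∑ i : Fin (n / 2),
              (u i : ℂ) *
                (2 * (Real.cos ((2 * (j : ℝ) + 1) * (2 * ((i : ℕ) : ℝ) + 1) * Real.pi / (2 * (n : ℝ))) : ℂ))) *
              Complex.exp (-(Complex.I * (2 * (j : ℂ) + 1) * (Real.pi : ℂ) / (2 * (n : ℂ))))) •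
          (fun k : Fin n =>
            Complex.exp (2 * (Real.pi : ℂ) * Complex.I * (2 * (j : ℂ) + 1) * ((k : ℕ) : ℂ) / (n : ℂ))) ∧
      norm
          ((∑ i : Fin (n / 2),
              (u i : ℂ) *
                (2 * (Real.cos ((2 * (j : ℝ) + 1) * (2 * ((i : ℕ) : ℝ) + 1) * Real.pi / (2 * (n : ℝ))) : ℂ))) *
            Complex.exp (-(Complex.I * (2 * (j : ℂ) + 1) * (Real.pi : ℂ) / (2 * (n : ℂ)))))
        = |∑ i : Fin (n / 2),
              (u i : ℝ) * (2 * Real.cos ((2 * (j : ℝ) + 1) * (2 * ((i : ℕ) : ℝ) + 1) * Real.pi / (2 * (n : ℝ))))|)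
    ∧ Matrix.vecMul (fun _ : Fin n => (1 : ℂ)) (∑ i : Fin (n / 2), ((u i : ℂ)) • elemMat n (i : ℕ)) = 0 := by
  have hn0 : (n : ℂ) ≠ 0 := by exact_mod_cast hodd.pos.ne'
  refine ⟨fun j _ => ⟨?_, ?_⟩, ?_⟩
  · set t : ℂ := (2 * (j : ℂ) + 1) * Real.pi / (2 * n) with ht
    have hroot : Complex.exp (t * Complex.I) ^ (2 * n) = -1 := by
      rw [← Complex.exp_nat_mul, show ((2 * n : ℕ) : ℂ) * (t * Complex.I) =
        Real.pi * Complex.I + j * (2 * Real.pi * Complex.I) by rw [ht]; push_cast; field_simp; ring,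
        Complex.exp_add, Complex.exp_nat_mul_two_pi_mul_I, Complex.exp_pi_mul_I, mul_one]
    have hunity : (Complex.exp (t * Complex.I) ^ 4) ^ n = 1 := by
      rw [← pow_mul, show 4 * n = 2 * n * 2 by ring, pow_mul, hroot]
      norm_num
    have hZ : (fun k : Fin n => Complex.exp (2 * (Real.pi : ℂ) * Complex.I * (2 * (j : ℂ) + 1) *
        ((k : ℕ) : ℂ) / (n : ℂ))) = fun k : Fin n => (Complex.exp (t * Complex.I) ^ 4) ^ (k : ℕ) := by
      funext k
      rw [← pow_mul, ← Complex.exp_nat_mul]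
      congr 1
      rw [ht]
      push_cast
      field_simp
      ring
    rw [hZ, vecMul_sum_smul_elemMat hodd _ hunity, Finset.sum_mul]
    congr 1
    refine Finset.sum_congr rfl fun i _ => ?_
    rw [elemMat_eigenvalue_eq_cos hodd _ hroot, mul_assoc (u i : ℂ)]
    push_cast
    congr 4 <;> rw [ht] <;> ring
  · rw [norm_mul, show -(Complex.I * (2 * (j : ℂ) + 1) * (Real.pi : ℂ) / (2 * (n : ℂ))) =
      ((-((2 * j + 1) * Real.pi / (2 * n)) : ℝ) : ℂ) * Complex.I by push_cast; ring,
      Complex.norm_exp_ofReal_mul_I, mul_one, ← Real.norm_eq_abs, ← Complex.norm_real]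
    push_cast
    rfl
  · have h := vecMul_sum_smul_elemMat hodd (fun i => (u i : ℂ)) (one_pow n)
    simpa [pow_succ] using h
end

section
/- Let a, b be natural numbers and let M = a·M_0(5) + b·M_1(5) (a 5×5 complex matrix). Then: (1) the row vector (1,1,1,1,1) satisfies (1,1,1,1,1)·M = 0; (2) the row vector Z_0 = (e^{2πik/5})_{0 ≤ k < 5} satisfies Z_0·M = λ_0·Z_0 with λ_0 = (2a·cos(π/10) + 2b·cos(3π/10))·e^{−iπ/10}; (3) the row vector Z_1 = (e^{6πik/5})_{0 ≤ k < 5} satisfies Z_1·M = λ_1·Z_1 with λ_1 = (2a·cos(3π/10) − 2b·cos(π/10))·e^{−3iπ/10}. In particular |λ_0| = |2a·cos(π/10) + 2b·cos(3π/10)| and |λ_1| = |2a·cos(3π/10) − 2b·cos(π/10)|. -/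
/-- The row vector of powers of a fifth root of unity is a left eigenvector of
`a·M_0(5) + b·M_1(5)`. -/
theorem vecMul_elemMat_five {z : ℂ} (hz : z ^ 5 = 1) (a b : ℂ) :
    Matrix.vecMul (fun k : Fin 5 => z ^ (k : ℕ)) (a • elemMat 5 0 + b • elemMat 5 1)
      = (a * (1 - z ^ 2) + b * (z ^ 4 - z ^ 3)) • (fun k : Fin 5 => z ^ (k : ℕ)) := by
  ext l
  fin_cases l <;> simp [Matrix.vecMul, dotProduct, Fin.sum_univ_five, elemMat] <;> grind

theorem exp_pi_mul_I_div_ten_pow (n : ℕ) :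
    Complex.exp (Real.pi * Complex.I / 10) ^ n = Complex.exp (n * (Real.pi * Complex.I / 10)) :=
  (Complex.exp_nat_mul _ n).symm

theorem exp_pi_mul_I_div_ten_pow_ten : Complex.exp (Real.pi * Complex.I / 10) ^ 10 = -1 := by
  rw [exp_pi_mul_I_div_ten_pow, ← Complex.exp_pi_mul_I]
  congr 1
  push_cast
  ring

/-- Exponentials at negative multiples of `πi/10`, as powers of `e^{πi/10}`. -/
theorem exp_neg_mul_pi_mul_I_div_ten {m n : ℕ} (h : m + n = 10) :
    Complex.exp (-(m * (Real.pi * Complex.I / 10)))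
      = -Complex.exp (Real.pi * Complex.I / 10) ^ n := by
  rw [Complex.exp_neg, ← exp_pi_mul_I_div_ten_pow]
  refine inv_eq_of_mul_eq_one_right ?_
  rw [mul_neg, ← pow_add, h, exp_pi_mul_I_div_ten_pow_ten, neg_neg]

theorem two_mul_cos_mul_pi_div_ten {m n : ℕ} (h : m + n = 10) :
    2 * Complex.cos (m * Real.pi / 10)
      = Complex.exp (Real.pi * Complex.I / 10) ^ m
        - Complex.exp (Real.pi * Complex.I / 10) ^ n := by
  rw [Complex.two_cos, sub_eq_add_neg, ← exp_neg_mul_pi_mul_I_div_ten h,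
    exp_pi_mul_I_div_ten_pow]
  congr 2 <;> ring

/-- eigenvalues of `M = a·M_0(5) + b·M_1(5)` on the all-ones vector,
on `Z_0 = (e^{2πik/5})_k` and on `Z_1 = (e^{6πik/5})_k`, together with the moduli of
the eigenvalues. -/
theorem five_fold_eigenvalues (a b : ℕ) :
    Matrix.vecMul (fun _ : Fin 5 => (1 : ℂ)) ((a : ℂ) • elemMat 5 0 + (b : ℂ) • elemMat 5 1) = 0 ∧
    Matrix.vecMul (fun k : Fin 5 => Complex.exp (2 * (Real.pi : ℂ) * Complex.I * ((k : ℕ) : ℂ) / 5))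
        ((a : ℂ) • elemMat 5 0 + (b : ℂ) • elemMat 5 1)
      = (((2 * (a : ℝ) * Real.cos (Real.pi / 10) + 2 * (b : ℝ) * Real.cos (3 * Real.pi / 10) : ℝ) : ℂ) *
            Complex.exp (-(Complex.I * (Real.pi : ℂ) / 10))) •
          (fun k : Fin 5 => Complex.exp (2 * (Real.pi : ℂ) * Complex.I * ((k : ℕ) : ℂ) / 5)) ∧
    Matrix.vecMul (fun k : Fin 5 => Complex.exp (6 * (Real.pi : ℂ) * Complex.I * ((k : ℕ) : ℂ) / 5))
        ((a : ℂ) • elemMat 5 0 + (b : ℂ) • elemMat 5 1)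
      = (((2 * (a : ℝ) * Real.cos (3 * Real.pi / 10) - 2 * (b : ℝ) * Real.cos (Real.pi / 10) : ℝ) : ℂ) *
            Complex.exp (-(3 * Complex.I * (Real.pi : ℂ) / 10))) •
          (fun k : Fin 5 => Complex.exp (6 * (Real.pi : ℂ) * Complex.I * ((k : ℕ) : ℂ) / 5)) ∧
    ‖((2 * (a : ℝ) * Real.cos (Real.pi / 10) + 2 * (b : ℝ) * Real.cos (3 * Real.pi / 10) : ℝ) : ℂ) *
          Complex.exp (-(Complex.I * (Real.pi : ℂ) / 10))‖
      = |2 * (a : ℝ) * Real.cos (Real.pi / 10) + 2 * (b : ℝ) * Real.cos (3 * Real.pi / 10)| ∧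
    ‖((2 * (a : ℝ) * Real.cos (3 * Real.pi / 10) - 2 * (b : ℝ) * Real.cos (Real.pi / 10) : ℝ) : ℂ) *
          Complex.exp (-(3 * Complex.I * (Real.pi : ℂ) / 10))‖
      = |2 * (a : ℝ) * Real.cos (3 * Real.pi / 10) - 2 * (b : ℝ) * Real.cos (Real.pi / 10)| := by
  set u : ℂ := Complex.exp (Real.pi * Complex.I / 10) with hu
  have hu10 : u ^ 10 = -1 := exp_pi_mul_I_div_ten_pow_ten
  have hcos1 : 2 * Complex.cos (Real.pi / 10) = u - u ^ 9 := by
    simpa using two_mul_cos_mul_pi_div_ten (m := 1) (n := 9) rfl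
  have hcos3 : 2 * Complex.cos (3 * Real.pi / 10) = u ^ 3 - u ^ 7 := by
    simpa using two_mul_cos_mul_pi_div_ten (m := 3) (n := 7) rfl
  have hexp1 : Complex.exp (-(Complex.I * Real.pi / 10)) = -u ^ 9 := by
    rw [hu, ← exp_neg_mul_pi_mul_I_div_ten (m := 1) rfl]
    congr 1
    push_cast
    ring
  have hexp3 : Complex.exp (-(3 * Complex.I * Real.pi / 10)) = -u ^ 7 := by
    rw [hu, ← exp_neg_mul_pi_mul_I_div_ten (m := 3) rfl]
    congr 1
    push_cast
    ring
  have hZ0 : (fun k : Fin 5 => Complex.exp (2 * (Real.pi : ℂ) * Complex.I * ((k : ℕ) : ℂ) / 5))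
      = fun k : Fin 5 => (u ^ 4) ^ (k : ℕ) := by
    funext k
    rw [← pow_mul, hu, exp_pi_mul_I_div_ten_pow]
    congr 1
    push_cast
    ring
  have hZ1 : (fun k : Fin 5 => Complex.exp (6 * (Real.pi : ℂ) * Complex.I * ((k : ℕ) : ℂ) / 5))
      = fun k : Fin 5 => (u ^ 12) ^ (k : ℕ) := by
    funext k
    rw [← pow_mul, hu, exp_pi_mul_I_div_ten_pow]
    congr 1
    push_cast
    ring
  have hz0 : (u ^ 4) ^ 5 = 1 := by
    rw [show (u ^ 4) ^ 5 = (u ^ 10) ^ 2 by ring, hu10]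
    norm_num
  have hz1 : (u ^ 12) ^ 5 = 1 := by
    rw [show (u ^ 12) ^ 5 = (u ^ 10) ^ 6 by ring, hu10]
    norm_num
  refine ⟨?_, ?_, ?_, ?_, ?_⟩
  · simpa using vecMul_elemMat_five (one_pow 5) (a : ℂ) (b : ℂ)
  · rw [hZ0, vecMul_elemMat_five hz0, hexp1]
    congr 1
    push_cast
    linear_combination a * u ^ 9 * hcos1 + b * u ^ 9 * hcos3 + a * (1 - u ^ 8) * hu10
  · rw [hZ1, vecMul_elemMat_five hz1, hexp3]
    congr 1
    rw [show u ^ 12 = -u ^ 2 by linear_combination u ^ 2 * hu10]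
    push_cast
    linear_combination
      a * u ^ 7 * hcos3 - b * u ^ 7 * hcos1 + (a * (1 - u ^ 4) + b * u ^ 6) * hu10
  · rw [norm_mul, Complex.norm_real, Real.norm_eq_abs, Complex.norm_exp]
    simp
  · rw [norm_mul, Complex.norm_real, Real.norm_eq_abs, Complex.norm_exp]
    simp
end

section
/- Let n ≥ 5 be an odd integer and set m = ⌊n/2⌋. There exists ε > 0 such that for every real x ≥ 2 and every vector v ∈ ℝ^m with ‖v − (x/(2‖γ‖²))·γ‖ < ε (Euclidean norm), the vector λ = N_n · v satisfies ‖(|λ_0|, |λ_1|, …, |λ_{m−1}|) − (x, 0, …, 0)‖ < 1; consequently |λ_0| > 1 and |λ_i| < 1 for every 1 ≤ i ≤ m−1. -/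
open Finset in
/-- The telescoping sum of cosines at odd multiples of an angle. -/
theorem two_mul_sin_mul_sum_cos_odd_mul (α : ℝ) (m : ℕ) :
    2 * Real.sin α * ∑ j ∈ range m, Real.cos ((2 * (j : ℝ) + 1) * α) =
      Real.sin (2 * (m : ℝ) * α) := by
  induction m with
  | zero => simp
  | succ m ih =>
    rw [sum_range_succ, mul_add, ih, Real.two_mul_sin_mul_cos]
    have h₁ : α - (2 * (m : ℝ) + 1) * α = -(2 * (m : ℝ) * α) := by ring
    have h₂ : α + (2 * (m : ℝ) + 1) * α = 2 * ((m + 1 : ℕ) : ℝ) * α := by push_cast; ring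
    rw [h₁, h₂, Real.sin_neg]
    ring

open Finset in
theorem two_mul_sum_cos_odd_mul_pi_div (m k : ℕ) (hk : 0 < k) (hkm : k < 2 * m + 1) :
    2 * ∑ j ∈ range m, Real.cos ((2 * (j : ℝ) + 1) * (k * Real.pi / (2 * m + 1))) =
      -(-1) ^ k := by
  set α : ℝ := k * Real.pi / (2 * m + 1) with hα
  have hk' : (0 : ℝ) < k := by exact_mod_cast hk
  have hkm' : (k : ℝ) < 2 * m + 1 := by exact_mod_cast hkm
  have hm : (0 : ℝ) < 2 * m + 1 := by positivity
  have hsin : 0 < Real.sin α := by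
    apply Real.sin_pos_of_pos_of_lt_pi
    · rw [hα]; positivity
    · rw [hα, div_lt_iff₀ hm, mul_comm]
      exact mul_lt_mul_of_pos_left hkm' Real.pi_pos
  have hangle : 2 * (m : ℝ) * α = k * Real.pi - α := by
    rw [hα]; field_simp; ring
  have h := two_mul_sin_mul_sum_cos_odd_mul α m
  rw [hangle, Real.sin_nat_mul_pi_sub] at h
  apply mul_left_cancel₀ hsin.ne'
  linarith

open Finset in
/-- Orthogonality of the first row of the eigenvalue matrix to the other rows. -/
theorem sum_two_mul_cos_mul_cos_eq_zero (m i : ℕ) (hi : 0 < i) (him : i < m) :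
    ∑ j ∈ range m, 2 * Real.cos ((2 * (i : ℝ) + 1) * (2 * (j : ℝ) + 1) * Real.pi /
        (2 * (2 * (m : ℝ) + 1))) *
      Real.cos ((2 * (j : ℝ) + 1) * Real.pi / (2 * (2 * (m : ℝ) + 1))) = 0 := by
  have h₁ := two_mul_sum_cos_odd_mul_pi_div m i hi (by omega)
  have h₂ := two_mul_sum_cos_odd_mul_pi_div m (i + 1) (by omega) (by omega)
  have hm : (2 * (m : ℝ) + 1) ≠ 0 := by positivity
  have hterm : ∀ j ∈ range m, 2 * Real.cos ((2 * (i : ℝ) + 1) * (2 * (j : ℝ) + 1) * Real.pi /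
        (2 * (2 * (m : ℝ) + 1))) *
      Real.cos ((2 * (j : ℝ) + 1) * Real.pi / (2 * (2 * (m : ℝ) + 1))) =
      Real.cos ((2 * (j : ℝ) + 1) * (i * Real.pi / (2 * m + 1))) +
      Real.cos ((2 * (j : ℝ) + 1) * ((i + 1 : ℕ) * Real.pi / (2 * m + 1))) := by
    intro j _
    rw [Real.two_mul_cos_mul_cos]
    congr 2
    · field_simp; ring
    · push_cast; field_simp; ring
  rw [sum_congr rfl hterm, sum_add_distrib]
  rw [pow_succ] at h₂
  linarith

/-- The eigenvalue matrix sends the optimal frequency vector to a multiple of the first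
coordinate vector. -/
theorem eigenvalueMatrix_mulVec_gamma (n : ℕ) (hodd : Odd n) (hpos : 0 < n / 2)
    (N : Matrix (Fin (n / 2)) (Fin (n / 2)) ℝ)
    (hN : ∀ i j : Fin (n / 2),
      N i j = 2 * Real.cos ((2 * ((i : ℕ) : ℝ) + 1) * (2 * ((j : ℕ) : ℝ) + 1) * Real.pi /
        (2 * (n : ℝ))))
    (γ : EuclideanSpace ℝ (Fin (n / 2)))
    (hγ : ∀ j : Fin (n / 2), γ j = Real.cos ((2 * ((j : ℕ) : ℝ) + 1) * Real.pi / (2 * (n : ℝ))))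
    (i : Fin (n / 2)) :
    N.mulVec γ i = if i = (⟨0, hpos⟩ : Fin (n / 2)) then 2 * ‖γ‖ ^ 2 else 0 := by
  have hn : (n : ℝ) = 2 * ((n / 2 : ℕ) : ℝ) + 1 := by
    exact_mod_cast (Nat.two_mul_div_two_add_one_of_odd hodd).symm
  simp only [Matrix.mulVec, dotProduct]
  split_ifs with h
  · subst h
    rw [EuclideanSpace.norm_sq_eq, Finset.mul_sum]
    refine Finset.sum_congr rfl fun j _ => ?_
    rw [hN, Real.norm_eq_abs, sq_abs, hγ]
    simp only [Nat.cast_zero, mul_zero, zero_add, one_mul]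
    ring
  · have hi : 0 < (i : ℕ) := Nat.pos_of_ne_zero fun h0 => h (Fin.ext h0)
    rw [← sum_two_mul_cos_mul_cos_eq_zero (n / 2) i hi i.isLt, ← hn, Finset.sum_range]
    exact Finset.sum_congr rfl fun j _ => by rw [hN, hγ]


/-- for odd `n ≥ 5` and `m = ⌊n/2⌋`, there is `ε > 0` such that whenever
`x ≥ 2` and `v ∈ ℝ^m` is `ε`-close to `(x/(2‖γ‖²))·γ` (γ the optimal frequency vector),
the vector `λ = N_n·v` satisfies `‖(|λ_0|,…,|λ_{m−1}|) − (x,0,…,0)‖ < 1`; consequently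
`|λ_0| > 1` and `|λ_i| < 1` for all `i ≠ 0`. -/
theorem approx_gamma_eigenvalues (n : ℕ) (hn : 5 ≤ n) (hodd : Odd n)
    (N : Matrix (Fin (n / 2)) (Fin (n / 2)) ℝ)
    (hN : ∀ i j : Fin (n / 2),
      N i j = 2 * Real.cos ((2 * ((i : ℕ) : ℝ) + 1) * (2 * ((j : ℕ) : ℝ) + 1) * Real.pi / (2 * (n : ℝ))))
    (γ : EuclideanSpace ℝ (Fin (n / 2)))
    (hγ : ∀ j : Fin (n / 2), γ j = Real.cos ((2 * ((j : ℕ) : ℝ) + 1) * Real.pi / (2 * (n : ℝ)))) :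
    ∃ ε > 0, ∀ x : ℝ, 2 ≤ x → ∀ v : EuclideanSpace ℝ (Fin (n / 2)),
      ‖v - (x / (2 * ‖γ‖ ^ 2)) • γ‖ < ε →
      ‖(show EuclideanSpace ℝ (Fin (n / 2)) from
          WithLp.toLp 2 fun i => |N.mulVec v i| - if i = (⟨0, by omega⟩ : Fin (n / 2)) then x else 0)‖ < 1 ∧
      1 < |N.mulVec v (⟨0, by omega⟩ : Fin (n / 2))| ∧
      ∀ i : Fin (n / 2), i ≠ (⟨0, by omega⟩ : Fin (n / 2)) → |N.mulVec v i| < 1 := by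
  have hpos : 0 < n / 2 := by omega
  have hγ0 : ‖γ‖ ^ 2 ≠ 0 := by
    have hcos : 0 < γ ⟨0, hpos⟩ := by
      have hn' : (1 : ℝ) < n := by exact_mod_cast (by omega : 1 < n)
      rw [hγ]
      apply Real.cos_pos_of_mem_Ioo
      simp only [Nat.cast_zero, mul_zero, zero_add, one_mul]
      constructor
      · have : 0 < Real.pi / (2 * (n : ℝ)) := by positivity
        linarith [Real.pi_pos]
      · exact div_lt_div_of_pos_left Real.pi_pos two_pos (by linarith)
    refine pow_ne_zero 2 (norm_ne_zero_iff.mpr fun h => ?_)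
    rw [h] at hcos
    simp at hcos
  set T := Matrix.toEuclideanCLM (𝕜 := ℝ) N with hT
  refine ⟨1 / (‖T‖ + 1), by positivity, fun x hx v hv => ?_⟩
  set w := v - (x / (2 * ‖γ‖ ^ 2)) • γ with hw
  have hTw : ‖T w‖ < 1 := by
    have hlt : (‖T‖ + 1) * ‖w‖ < 1 := by
      rwa [lt_div_iff₀' (by positivity)] at hv
    linarith [T.le_opNorm w, norm_nonneg w]
  have hTapply : ∀ i, T w i = N.mulVec v i - if i = (⟨0, hpos⟩ : Fin (n / 2)) then x else 0 := by
    intro i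
    have hcoord : T w i = N.mulVec w i := by
      rw [hT, Matrix.ofLp_toEuclideanCLM]
    rw [hcoord, hw, WithLp.ofLp_sub, WithLp.ofLp_smul, Matrix.mulVec_sub, Matrix.mulVec_smul,
      Pi.sub_apply, Pi.smul_apply, eigenvalueMatrix_mulVec_gamma n hodd hpos N hN γ hγ]
    split_ifs
    · rw [smul_eq_mul, div_mul_cancel₀ _ (mul_ne_zero two_ne_zero hγ0)]
    · simp
  have habs : ∀ i, |(|N.mulVec v i| - if i = (⟨0, hpos⟩ : Fin (n / 2)) then x else 0)| ≤
      |T w i| := by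
    intro i
    rw [hTapply]
    split_ifs
    · simpa [abs_of_nonneg (by linarith : 0 ≤ x)] using abs_abs_sub_abs_le (N.mulVec v i) x
    · simp
  have hcoord_lt : ∀ i, |(|N.mulVec v i| - if i = (⟨0, hpos⟩ : Fin (n / 2)) then x else 0)| < 1 :=
    fun i => (habs i).trans_lt ((PiLp.norm_apply_le (T w) i).trans_lt hTw)
  refine ⟨lt_of_le_of_lt ?_ hTw, ?_, fun i hi => ?_⟩
  · rw [EuclideanSpace.norm_eq, EuclideanSpace.norm_eq]
    refine Real.sqrt_le_sqrt (Finset.sum_le_sum fun i _ => ?_)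
    exact pow_le_pow_left₀ (norm_nonneg _) (habs i) 2
  · have h := hcoord_lt ⟨0, hpos⟩
    rw [if_pos rfl, abs_lt] at h
    linarith [h.1]
  · simpa [hi] using hcoord_lt i
end

section
/- Let n ≥ 5 be an odd integer, set m = ⌊n/2⌋, and let γ ∈ ℝ^m be the vector with coordinates γ_j = cos((2j+1)π/(2n)) for 0 ≤ j < m. For each real t ≥ 0 let p(t) ∈ ℤ^m be the point with coordinates p(t)_j = ⌊t·γ_j + 1/2⌋. Then for every ε > 0 and every T > 0 there exists t > T such that the Euclidean distance from p(t) to the real line ℝ·γ = {s·γ : s ∈ ℝ} is strictly less than ε. -/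
/-- The multiples `t • γ` of a vector come arbitrarily close to the integer points obtained by
rounding their coordinates, for arbitrarily large `t`. -/
theorem exists_gt_norm_floor_add_half_sub_smul_lt {ι : Type*} [Fintype ι]
    (γ : EuclideanSpace ℝ ι) {ε : ℝ} (hε : 0 < ε) (T : ℝ) :
    ∃ t : ℝ, T < t ∧
      ‖(WithLp.toLp 2 fun j => ((⌊t * γ j + 1 / 2⌋ : ℤ) : ℝ) : EuclideanSpace ℝ ι) - t • γ‖ < ε := by
  let x : ℕ → EuclideanSpace ℝ ι := fun k => WithLp.toLp 2 fun j => Int.fract ((k : ℝ) * γ j)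
  have hx : ∀ k, x k ∈ Metric.closedBall (0 : EuclideanSpace ℝ ι) √(Fintype.card ι) := by
    intro k
    rw [mem_closedBall_zero_iff, EuclideanSpace.norm_eq]
    apply Real.sqrt_le_sqrt
    calc ∑ j, ‖x k j‖ ^ 2 ≤ ∑ _j : ι, (1 : ℝ) := by
          refine Finset.sum_le_sum fun j _ => ?_
          have h0 : 0 ≤ x k j := Int.fract_nonneg _
          have h1 : x k j < 1 := Int.fract_lt_one _
          rw [Real.norm_of_nonneg h0]
          nlinarith
      _ = Fintype.card ι := by simp
  obtain ⟨_, _, φ, hφ, hlim⟩ := tendsto_subseq_of_bounded Metric.isBounded_closedBall hx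
  obtain ⟨N, hN⟩ := Metric.cauchySeq_iff.1 hlim.cauchySeq (min ε (1 / 2)) (by positivity)
  obtain ⟨K, hK⟩ := exists_nat_gt T
  have hd := hN N le_rfl (N + K) (Nat.le_add_right N K)
  simp only [Function.comp_apply, dist_eq_norm] at hd
  have hgap : φ N + K ≤ φ (N + K) := by
    have := hφ.add_le_nat K N
    rwa [Nat.add_comm, Nat.add_comm N]
  refine ⟨(φ (N + K) : ℝ) - φ N, ?_, ?_⟩
  · have : ((φ N + K : ℕ) : ℝ) ≤ φ (N + K) := by exact_mod_cast hgap
    push_cast at this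
    linarith
  · refine lt_of_eq_of_lt (congrArg norm ?_) (hd.trans_le (min_le_left _ _))
    ext j
    have hj : |x (φ N) j - x (φ (N + K)) j| < 1 / 2 :=
      ((PiLp.norm_apply_le (x (φ N) - x (φ (N + K))) j).trans_lt hd).trans_le (min_le_right _ _)
    obtain ⟨hl, hu⟩ := abs_lt.1 hj
    have ha : x (φ N) j = φ N * γ j - ⌊(φ N : ℝ) * γ j⌋ := rfl
    have hb : x (φ (N + K)) j = φ (N + K) * γ j - ⌊(φ (N + K) : ℝ) * γ j⌋ := rfl
    have hfl : ⌊((φ (N + K) : ℝ) - φ N) * γ j + 1 / 2⌋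
        = ⌊(φ (N + K) : ℝ) * γ j⌋ - ⌊(φ N : ℝ) * γ j⌋ := by
      rw [Int.floor_eq_iff]
      push_cast
      constructor <;> linarith
    simp only [PiLp.sub_apply, PiLp.smul_apply, smul_eq_mul, hfl, ha, hb]
    push_cast
    ring

/-- for odd `n ≥ 5`, `m = ⌊n/2⌋` and the optimal frequency vector `γ`,
the billiard sequence points `p(t) = (⌊t·γ_j + 1/2⌋)_j` approach the line `ℝ·γ`:
for every `ε > 0` and `T > 0` there exists `t > T` whose point `p(t)` is within
distance `ε` of the line, i.e. there is `s : ℝ` with `‖p(t) − s·γ‖ < ε`. -/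
theorem billiard_tracks_gamma_line (n : ℕ) (hn : 5 ≤ n) (hodd : Odd n)
    (γ : EuclideanSpace ℝ (Fin (n / 2)))
    (hγ : ∀ j : Fin (n / 2), γ j = Real.cos ((2 * ((j : ℕ) : ℝ) + 1) * Real.pi / (2 * (n : ℝ)))) :
    ∀ ε > (0 : ℝ), ∀ T > (0 : ℝ), ∃ t : ℝ, T < t ∧
      ∃ s : ℝ,
        ‖(show EuclideanSpace ℝ (Fin (n / 2)) from
            WithLp.toLp 2 fun j => ((⌊t * γ j + 1 / 2⌋ : ℤ) : ℝ)) - s • γ‖ < ε := by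
  intro ε hε T _
  obtain ⟨t, hT, h⟩ := exists_gt_norm_floor_add_half_sub_smul_lt γ hε T
  exact ⟨t, hT, t, h⟩
end

section
/- Let n ≥ 5 be an odd integer and let u = u_0 … u_{m−1} be a finite word over the alphabet {1, 3, 5, …, n−2} of odd numbers which is 2-almost-balanced, i.e., for any odd letters j_1 < j_2 and every factor (contiguous subword) v of u, |v|_{j_1} − |v|_{j_2} ≥ −2. Assume the total counts are strictly decreasing and positive: f_1(m) > f_3(m) > … > f_{n−2}(m) > 0. Then for every integer k with 0 < k < n, all odd letters j_1 < j_2 in {1, 3, …, n−2} with |j_1 − 2k| ≤ n, and every position k_1 with 1 ≤ k_1 ≤ m, u_{k_1−1} = j_1 and f_{j_1}(k_1) > F_{|j_1−2k|}(m), one has f_{j_2}^{-1}(f_{j_2}(k_1) − F_{|j_2−2k|}(m)) < f_{j_1}^{-1}(f_{j_1}(k_1) − F_{|j_1−2k|}(m)) in ℕ ∪ {∞}. -/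
/-- `cnt u j x`: the number of occurrences of the letter `j` among the first `x`
letters of the word `u` (the counting function `f_j(x)`). -/
def cnt (u : List ℕ) (j x : ℕ) : ℕ := (u.take x).count j

open Classical in
/-- `cntInv u j y`: the generalized inverse `f_j⁻¹(y) ∈ ℕ ∪ {∞}`: `0` if `y ≤ 0`,
the least `x` with `f_j(x) = y` if one exists, and `∞` otherwise. -/
noncomputable def cntInv (u : List ℕ) (j : ℕ) (y : ℤ) : ℕ∞ :=
  if y ≤ 0 then 0
  else if ∃ x : ℕ, (cnt u j x : ℤ) = y then ((sInf {x : ℕ | (cnt u j x : ℤ) = y} : ℕ) : ℕ∞)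
  else ⊤

/-- `Fext u n j`: the extended total count `F_j(m) ∈ ℤ` for odd `1 ≤ j < 2n`:
`f_j(m)` if `j ≤ n−2`, `0` if `j = n`, and `−f_{2n−j}(m)` if `n < j < 2n`. -/
def Fext (u : List ℕ) (n j : ℕ) : ℤ :=
  if j ≤ n - 2 then (cnt u j u.length : ℤ)
  else if j = n then 0
  else -((cnt u (2 * n - j) u.length : ℤ))

theorem cnt_succ (u : List ℕ) (j x : ℕ) :
    cnt u j (x + 1) = cnt u j x + if u[x]? = some j then 1 else 0 := by
  unfold cnt
  rw [List.take_add_one, List.count_append]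
  cases h : u[x]? with
  | none => simp
  | some a => simp [List.count_singleton]

theorem cnt_mono (u : List ℕ) (j : ℕ) : Monotone (cnt u j) :=
  monotone_nat_of_le_succ fun x => by rw [cnt_succ]; omega

/-- The increment of `cnt` over an interval is the letter count of the corresponding factor. -/
theorem cnt_eq_add_count_drop (u : List ℕ) (j : ℕ) {x y : ℕ} (hxy : x ≤ y) :
    cnt u j y = cnt u j x + ((u.take y).drop x).count j := by
  unfold cnt
  conv_lhs => rw [← List.take_append_drop x (u.take y), List.count_append, List.take_take,
    min_eq_left hxy]

/-- A positive value `y ≤ f_j(x)` is first attained at a position `z ≤ x` preceded by `j`. -/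
theorem exists_cntInv_eq (u : List ℕ) (j x y : ℕ) (hy : 0 < y) (hyx : y ≤ cnt u j x) :
    ∃ z, 0 < z ∧ z ≤ x ∧ cnt u j z = y ∧ u[z - 1]? = some j ∧
      cntInv u j (y : ℤ) = (z : ℕ∞) := by
  classical
  have hex : ∃ z, y ≤ cnt u j z := ⟨x, hyx⟩
  obtain ⟨z, hz, hmin⟩ : ∃ z, y ≤ cnt u j z ∧ ∀ w < z, cnt u j w < y :=
    ⟨Nat.find hex, Nat.find_spec hex, fun w hw => not_le.mp (Nat.find_min hex hw)⟩
  have hzx : z ≤ x := not_lt.mp fun h => absurd (hmin x h) (not_lt.mpr hyx)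
  obtain _ | w := z
  · simp [cnt] at hz
    omega
  have hw := hmin w (Nat.lt_succ_self w)
  have hstep := cnt_succ u j w
  have hletter : u[w]? = some j := by
    by_contra h
    rw [if_neg h] at hstep
    omega
  rw [if_pos hletter] at hstep
  have hval : cnt u j (w + 1) = y := by omega
  refine ⟨w + 1, Nat.succ_pos w, hzx, hval, by simpa using hletter, ?_⟩
  have hleast : IsLeast {x : ℕ | (cnt u j x : ℤ) = y} (w + 1) := by
    refine ⟨by simp [hval], fun v hv => ?_⟩
    by_contra! h
    have := hmin v h
    simp only [Set.mem_ofPred_eq, Nat.cast_inj] at hv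
    omega
  unfold cntInv
  rw [if_neg (by omega), if_pos ⟨w + 1, by rw [hval]⟩, hleast.csInf_eq]

theorem cntInv_lt (u : List ℕ) (j x : ℕ) (y : ℤ) (hx : 0 < x) (hyx : y ≤ cnt u j x)
    (hne : u[x - 1]? ≠ some j) : cntInv u j y < x := by
  by_cases hy : y ≤ 0
  · unfold cntInv
    rw [if_pos hy]
    exact_mod_cast hx
  · lift y to ℕ using by omega
    obtain ⟨z, -, hzx, -, hlz, hinv⟩ := exists_cntInv_eq u j x y (by omega) (by omega)
    rw [hinv]
    have : z ≠ x := fun h => hne (h ▸ hlz)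
    exact_mod_cast lt_of_le_of_ne hzx this

theorem cnt_length_lt_of_lt {n : ℕ} {u : List ℕ}
    (hdec : ∀ j : ℕ, Odd j → 1 ≤ j → j ≤ n - 4 →
      cnt u (j + 2) u.length < cnt u j u.length)
    {i j : ℕ} (hi : Odd i) (hj : Odd j) (hij : i < j) (hjn : j ≤ n - 2) :
    cnt u j u.length < cnt u i u.length := by
  obtain ⟨a, rfl⟩ := hi
  obtain ⟨b, rfl⟩ := hj
  obtain ⟨d, rfl⟩ : ∃ d, b = a + d + 1 := ⟨b - a - 1, by omega⟩
  induction d with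
  | zero => exact hdec (2 * a + 1) ⟨a, rfl⟩ (by omega) (by omega)
  | succ d ih =>
    exact (hdec (2 * (a + d + 1) + 1) ⟨_, rfl⟩ (by omega) (by omega)).trans
      (ih (by omega) (by omega))

theorem Fext_nonneg {n : ℕ} (u : List ℕ) {j : ℕ} (hn : Odd n) (hj : Odd j) (hjn : j ≤ n) :
    0 ≤ Fext u n j := by
  unfold Fext
  split_ifs with h₁ h₂
  · positivity
  · exact le_rfl
  · obtain ⟨a, rfl⟩ := hn
    obtain ⟨b, rfl⟩ := hj
    omega

theorem Fext_lt_of_lt {n : ℕ} {u : List ℕ} (hn : Odd n)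
    (hdec : ∀ j : ℕ, Odd j → 1 ≤ j → j ≤ n - 4 →
      cnt u (j + 2) u.length < cnt u j u.length)
    (hpos : 0 < cnt u (n - 2) u.length)
    {i j : ℕ} (hi : Odd i) (hj : Odd j) (hij : i < j) (hjn : j ≤ n) :
    Fext u n j < Fext u n i := by
  have hin : i ≤ n - 2 := by
    obtain ⟨a, rfl⟩ := hi
    obtain ⟨b, rfl⟩ := hj
    omega
  have hFi : Fext u n i = cnt u i u.length := if_pos hin
  rw [hFi]
  by_cases h : j ≤ n - 2
  · rw [show Fext u n j = cnt u j u.length from if_pos h]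
    exact_mod_cast cnt_length_lt_of_lt hdec hi hj hij h
  · have hjeq : j = n := by
      obtain ⟨a, rfl⟩ := hn
      obtain ⟨b, rfl⟩ := hj
      omega
    rw [show Fext u n j = 0 by unfold Fext; rw [if_neg h, if_pos hjeq]]
    rcases hin.lt_or_eq with hlt | rfl
    · have hn2 : Odd (n - 2) := by
        obtain ⟨a, rfl⟩ := hn
        exact ⟨a - 1, by omega⟩
      exact_mod_cast hpos.trans (cnt_length_lt_of_lt hdec hi hn2 hlt le_rfl)
    · exact_mod_cast hpos

/-- for a 2-almost-balanced word `u` over the odd alphabet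
`{1,3,…,n−2}` (`n ≥ 5` odd) with strictly decreasing positive total counts
`f_1(m) > f_3(m) > … > f_{n−2}(m) > 0`, for all `0 < k < n`, odd letters
`j₁ < j₂` with `|j₁ − 2k| ≤ n`, and positions `k₁` with `u_{k₁−1} = j₁` and
`f_{j₁}(k₁) > F_{|j₁−2k|}(m)`, one has
`f_{j₂}⁻¹(f_{j₂}(k₁) − F_{|j₂−2k|}(m)) < f_{j₁}⁻¹(f_{j₁}(k₁) − F_{|j₁−2k|}(m))`. -/
theorem counting_opposite (n : ℕ) (hn : 5 ≤ n) (hodd : Odd n) (u : List ℕ)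
    (halph : ∀ c ∈ u, Odd c ∧ 1 ≤ c ∧ c ≤ n - 2)
    (hbal : ∀ j1 j2 : ℕ, Odd j1 → Odd j2 → 1 ≤ j1 → j1 < j2 → j2 ≤ n - 2 →
      ∀ v : List ℕ, v <:+: u → -2 ≤ (v.count j1 : ℤ) - (v.count j2 : ℤ))
    (hdec : ∀ j : ℕ, Odd j → 1 ≤ j → j ≤ n - 4 →
      cnt u (j + 2) u.length < cnt u j u.length)
    (hpos : 0 < cnt u (n - 2) u.length) :
    ∀ k : ℕ, 0 < k → k < n →
    ∀ j1 j2 : ℕ, Odd j1 → Odd j2 → 1 ≤ j1 → j1 < j2 → j2 ≤ n - 2 →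
    ((j1 : ℤ) - 2 * (k : ℤ)).natAbs ≤ n →
    ∀ k1 : ℕ, 1 ≤ k1 → k1 ≤ u.length → u[k1 - 1]? = some j1 →
    Fext u n ((j1 : ℤ) - 2 * (k : ℤ)).natAbs < (cnt u j1 k1 : ℤ) →
    cntInv u j2 ((cnt u j2 k1 : ℤ) - Fext u n ((j2 : ℤ) - 2 * (k : ℤ)).natAbs) <
      cntInv u j1 ((cnt u j1 k1 : ℤ) - Fext u n ((j1 : ℤ) - 2 * (k : ℤ)).natAbs) := by
  intro k hk hkn j1 j2 hj1 hj2 h1 h12 h2n ha k1 hk1 hk1m hlast hF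
  obtain ⟨a, hadef⟩ : ∃ a, a = ((j1 : ℤ) - 2 * (k : ℤ)).natAbs := ⟨_, rfl⟩
  obtain ⟨b, hbdef⟩ : ∃ b, b = ((j2 : ℤ) - 2 * (k : ℤ)).natAbs := ⟨_, rfl⟩
  rw [← hadef] at ha hF ⊢
  rw [← hbdef]
  have haodd : Odd a := by
    obtain ⟨t, rfl⟩ := hj1
    rw [Nat.odd_iff]
    omega
  have hbodd : Odd b := by
    obtain ⟨t, rfl⟩ := hj2
    rw [Nat.odd_iff]
    omega
  have hFa := Fext_nonneg u hodd haodd ha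
  obtain ⟨y, hy⟩ : ∃ y : ℕ, (y : ℤ) = (cnt u j1 k1 : ℤ) - Fext u n a :=
    ⟨((cnt u j1 k1 : ℤ) - Fext u n a).toNat, by omega⟩
  obtain ⟨x, hx, hxk, hcx, hlx, hinv⟩ :=
    exists_cntInv_eq u j1 k1 y (by omega) (by omega)
  rw [← hy, hinv]
  refine cntInv_lt u j2 x _ hx ?_ (by rw [hlx]; simpa using h12.ne)
  by_cases hkj : k < j2
  · have hFb := Fext_lt_of_lt hodd hdec hpos hbodd hj2 (by omega) (by omega)
    rw [show Fext u n j2 = cnt u j2 u.length from if_pos h2n] at hFb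
    have := cnt_mono u j2 hk1m
    omega
  · have hFb := Fext_lt_of_lt hodd hdec hpos hbodd haodd (by omega) ha
    rcases hxk.eq_or_lt with rfl | hlt
    · omega
    · -- Compare the two letters on the factor from `x` to `k1`, without its last letter `j1`.
      obtain ⟨p, rfl⟩ : ∃ p, k1 = p + 1 := ⟨k1 - 1, by omega⟩
      rw [Nat.add_sub_cancel] at hlast
      have hs1 := cnt_succ u j1 p
      have hs2 := cnt_succ u j2 p
      rw [hlast, if_pos rfl] at hs1
      rw [hlast, if_neg (by simpa using h12.ne)] at hs2
      have hd1 := cnt_eq_add_count_drop u j1 (Nat.le_of_lt_succ hlt)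
      have hd2 := cnt_eq_add_count_drop u j2 (Nat.le_of_lt_succ hlt)
      have := hbal j1 j2 hj1 hj2 h1 h12 h2n _
        ((List.drop_suffix x (u.take p)).isInfix.trans (List.take_prefix p u).isInfix)
      omega
end
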